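/- Let X ⊆ ℝ^{n_x}. Let f : ℝ^{n_x} → ℝ^{n_x} be a bijection with f⁻¹ globally Lipschitz with constant c_f > 0, and h = (h_1,…,h_{n_y}) : ℝ^{n_x} → ℝ^{n_y} globally Lipschitz with constant c_h > 0. Assume the system is Lipschitz backward distinguishable on X: for each i ∈ {1,…,n_y} there is m_i ∈ ℕ, m_i ≥ 1, such that the backward distinguishability map 𝒪(x) = (𝒪_1(x),…,𝒪_{n_y}(x)), where 𝒪_i(x) = (h_i(f⁻¹(x)), h_i((f⁻¹)^{∘2}(x)), …, h_i((f⁻¹)^{∘m_i}(x))) ∈ ℝ^{m_i}, satisfies ‖𝒪(x_a) − 𝒪(x_b)‖ ≥ c_o ‖x_a − x_b‖ for all x_a, x_b ∈ X, for some c_o > 0. For each i let (Ã_i, B̃_i) ∈ ℝ^{m_i×m_i} × ℝ^{m_i} be a controllable pair with Ã_i Schur, set n_z = Σ_i m_i, m̄ = max_i m_i, and for γ > 0 set A = γ·diag(Ã_1,…,Ã_{n_y}) ∈ ℝ^{n_z×n_z} and B = diag(B̃_1,…,B̃_{n_y}) ∈ ℝ^{n_z×n_y}. Then there exist γ* ∈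 (0,1] and c_I > 0 (independent of γ) such that for all γ ∈ (0, γ*), the map T(x) = Σ_{j=0}^{∞} Aʲ B h((f⁻¹)^{∘(j+1)}(x)) is well defined on X and is Lipschitz injective on X with ‖T(x_a) − T(x_b)‖ ≥ c_I · γ^{m̄−1} · ‖x_a − x_b‖ for all x_a, x_b ∈ X. -/

import Mathlib

open Matrix

attribute [local instance] Matrix.linftyOpNormedAddCommGroup

/-- A real square matrix is Schur if all of its complex eigenvalues have modulus `< 1`,
i.e. its spectral radius is strictly less than `1`. -/
def IsSchur {m : Type*} [Fintype m] [DecidableEq m] (A : Matrix m m ℝ) : Prop :=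
  ∀ μ ∈ spectrum ℂ (A.map (algebraMap ℝ ℂ)), ‖μ‖ < 1

/-- The block "diagonal" matrix `B = diag(B̃_1, …, B̃_{n_y})` built from the columns
`B̃_i ∈ ℝ^{m_i}`. -/
noncomputable def Bdiag {ny : ℕ} {m : Fin ny → ℕ} (Bt : ∀ i, Fin (m i) → ℝ) :
    Matrix (Σ i : Fin ny, Fin (m i)) (Fin ny) ℝ :=
  Matrix.of fun p k => if p.1 = k then Bt p.1 p.2 else 0

/-- The backward distinguishability map `𝒪`, with components
`𝒪_i(x) = (h_i(f⁻¹(x)), …, h_i((f⁻¹)^{∘ m_i}(x)))`, where `g` plays the role of `f⁻¹`. -/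
def obsMap {nx ny : ℕ} (m : Fin ny → ℕ) (g : (Fin nx → ℝ) → (Fin nx → ℝ))
    (h : (Fin nx → ℝ) → (Fin ny → ℝ)) (x : Fin nx → ℝ) :
    (Σ i : Fin ny, Fin (m i)) → ℝ :=
  fun p => h (g^[(p.2 : ℕ) + 1] x) p.1

/-- The controllability matrix `(B̃, ÃB̃, …, Ã^{m-1}B̃)` of a pair `(Ã, B̃)`. -/
def ctrbMat {mi : ℕ} (At : Matrix (Fin mi) (Fin mi) ℝ) (Bt : Fin mi → ℝ) :
    Matrix (Fin mi) (Fin mi) ℝ :=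
  Matrix.of fun j k => ((At ^ (k : ℕ)) *ᵥ Bt) j

theorem norm_pow_mulVec_le {n : Type*} [Fintype n] [DecidableEq n] (A : Matrix n n ℝ)
    (v : n → ℝ) (j : ℕ) : ‖A ^ j *ᵥ v‖ ≤ ‖A‖ ^ j * ‖v‖ := by
  induction j with
  | zero => simp
  | succ j ih =>
    rw [pow_succ', ← Matrix.mulVec_mulVec, pow_succ', mul_assoc]
    exact (Matrix.linfty_opNorm_mulVec A _).trans
      (mul_le_mul_of_nonneg_left ih (norm_nonneg _))

/-- For a controllable pair `(A, b)`, the filtered series `∑ d_j γ^j A^j b` dominates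
`γ^(n-1) R` for small `γ`, if `d` grows at most geometrically and one of its first `n`
entries is at least `η R`. -/
theorem eventually_le_norm_tsum_of_controllable {n : ℕ} (A : Matrix (Fin n) (Fin n) ℝ)
    (b : Fin n → ℝ) (hC : IsUnit (ctrbMat A b).det) {c η : ℝ} (hc : 0 ≤ c) (hη : 0 < η) :
    ∀ᶠ k in nhdsWithin (0 : ℝ) (Set.Ioi 0), ∀ᶠ γ in nhdsWithin (0 : ℝ) (Set.Ioi 0),
      ∀ (d : ℕ → ℝ) (R : ℝ), 0 ≤ R →
      (∀ j, |d j| ≤ c ^ j * R) → ∀ l : Fin n, η * R ≤ |d l| →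
      k * γ ^ (n - 1) * R ≤ ‖∑' j : ℕ, (d j * γ ^ j) • (A ^ j *ᵥ b)‖ := by
  set C := ctrbMat A b with hCdef
  set q := ‖C⁻¹‖ + 1 with hq
  have hq0 : 0 < q := by positivity
  set a := ‖A‖ with ha
  have ha0 : 0 ≤ a := norm_nonneg _
  set K := 2 * ‖b‖ * (c * a) ^ n with hK
  have hK0 : 0 ≤ K := by positivity
  have hk : ∀ᶠ k in nhdsWithin (0 : ℝ) (Set.Ioi 0), k < η / q / 2 :=
    nhdsWithin_le_nhds (eventually_lt_nhds (by positivity))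
  filter_upwards [hk] with k hk
  have h1 : ∀ᶠ γ in nhds (0 : ℝ), c * a * γ < 1 / 2 :=
    (by fun_prop : Continuous fun γ : ℝ => c * a * γ).continuousAt.eventually_lt_const
      (by norm_num)
  have h2 : ∀ᶠ γ in nhds (0 : ℝ), K * γ < η / q / 2 :=
    (by fun_prop : Continuous fun γ : ℝ => K * γ).continuousAt.eventually_lt_const
      (by simp only [mul_zero]; positivity)
  have h3 : ∀ᶠ γ in nhds (0 : ℝ), γ < 1 := eventually_lt_nhds one_pos
  filter_upwards [self_mem_nhdsWithin, nhdsWithin_le_nhds h1, nhdsWithin_le_nhds h2,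
    nhdsWithin_le_nhds h3] with γ hγ h1 h2 h3 d R hR hd l hl
  have hγ0 : 0 < γ := hγ
  set r := c * a * γ with hr
  have hr0 : 0 ≤ r := by positivity
  set F : ℕ → Fin n → ℝ := fun j => (d j * γ ^ j) • (A ^ j *ᵥ b) with hF
  have hFb : ∀ j, ‖F j‖ ≤ R * ‖b‖ * r ^ j := fun j => by
    calc ‖F j‖ = |d j| * γ ^ j * ‖A ^ j *ᵥ b‖ := by
          rw [hF, norm_smul, norm_mul, Real.norm_eq_abs, Real.norm_of_nonneg (by positivity)]
      _ ≤ (c ^ j * R) * γ ^ j * (a ^ j * ‖b‖) := by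
          gcongr
          · exact hd j
          · exact norm_pow_mulVec_le A b j
      _ = R * ‖b‖ * r ^ j := by rw [hr, mul_pow, mul_pow]; ring
  have hgeo : Summable fun j : ℕ => R * ‖b‖ * r ^ j :=
    (summable_geometric_of_lt_one hr0 (by linarith)).mul_left _
  have hFs : Summable F := Summable.of_norm_bounded hgeo hFb
  have hn : 1 ≤ n := l.pos
  have htail : ‖∑' j, F (j + n)‖ ≤ γ ^ (n - 1) * R * (K * γ) := by
    have hs : HasSum (fun j : ℕ => R * ‖b‖ * r ^ n * r ^ j) (R * ‖b‖ * r ^ n * (1 - r)⁻¹) :=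
      (hasSum_geometric_of_lt_one hr0 (by linarith)).mul_left _
    have hle := tsum_of_norm_bounded hs (f := fun j => F (j + n)) fun j =>
      (hFb (j + n)).trans_eq (by ring)
    have hinv : (1 - r)⁻¹ ≤ 2 := by
      rw [inv_le_comm₀ (by linarith) two_pos]
      linarith
    calc _ ≤ R * ‖b‖ * r ^ n * (1 - r)⁻¹ := hle
      _ ≤ R * ‖b‖ * r ^ n * 2 := by gcongr
      _ = _ := by
          obtain ⟨p, rfl⟩ : ∃ p, n = p + 1 := ⟨n - 1, by omega⟩
          rw [hr, hK, Nat.add_sub_cancel]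
          ring
  set u : Fin n → ℝ := fun j => d j * γ ^ (j : ℕ) with hu
  have hhead : ∑ j ∈ Finset.range n, F j = C *ᵥ u := by
    rw [Finset.sum_range]
    ext p
    simp only [hF, hCdef, ctrbMat, hu, Finset.sum_apply, Pi.smul_apply, smul_eq_mul,
      Matrix.mulVec, dotProduct, Matrix.of_apply]
    exact Finset.sum_congr rfl fun j _ => mul_comm _ _
  have hlow : η / q * (γ ^ (n - 1) * R) ≤ ‖C *ᵥ u‖ := by
    have hinv : u = C⁻¹ *ᵥ (C *ᵥ u) := by
      rw [Matrix.mulVec_mulVec, Matrix.nonsing_inv_mul _ hC, Matrix.one_mulVec]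
    have h4 : ‖u‖ ≤ q * ‖C *ᵥ u‖ := by
      conv_lhs => rw [hinv]
      exact (Matrix.linfty_opNorm_mulVec _ _).trans
        (mul_le_mul_of_nonneg_right (by linarith) (norm_nonneg _))
    have h5 : η * R * γ ^ (n - 1) ≤ ‖u‖ := by
      calc η * R * γ ^ (n - 1) ≤ |d l| * γ ^ (l : ℕ) :=
            mul_le_mul hl (pow_le_pow_of_le_one hγ0.le h3.le (by omega)) (by positivity)
              (abs_nonneg _)
        _ = ‖u l‖ := by
            rw [hu, norm_mul, Real.norm_eq_abs, Real.norm_of_nonneg (by positivity)]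
        _ ≤ ‖u‖ := norm_le_pi_norm u l
    rw [div_mul_eq_mul_div, div_le_iff₀ hq0]
    linarith
  rw [← hFs.sum_add_tsum_nat_add n, hhead]
  have h6 := norm_sub_le_norm_add (C *ᵥ u) (∑' j, F (j + n))
  have h7 : 0 ≤ γ ^ (n - 1) * R := by positivity
  nlinarith

/-- Restriction of a vector indexed by a sigma type to one block. -/
noncomputable def blockProj {ι : Type*} [Fintype ι] (m : ι → ℕ) (i : ι) :
    ((Σ i : ι, Fin (m i)) → ℝ) →L[ℝ] (Fin (m i) → ℝ) :=
  ContinuousLinearMap.pi fun l => ContinuousLinearMap.proj ⟨i, l⟩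

theorem blockProj_apply {ι : Type*} [Fintype ι] (m : ι → ℕ) (i : ι)
    (v : (Σ i : ι, Fin (m i)) → ℝ) (l : Fin (m i)) : blockProj m i v l = v ⟨i, l⟩ := rfl

theorem norm_blockProj_le {ι : Type*} [Fintype ι] (m : ι → ℕ) (i : ι)
    (v : (Σ i : ι, Fin (m i)) → ℝ) : ‖blockProj m i v‖ ≤ ‖v‖ :=
  (pi_norm_le_iff_of_nonneg (norm_nonneg _)).2 fun l => norm_le_pi_norm v ⟨i, l⟩

theorem blockProj_blockDiagonal'_mulVec {ι : Type*} [Fintype ι] [DecidableEq ι] (m : ι → ℕ)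
    (i : ι) (A : ∀ i, Matrix (Fin (m i)) (Fin (m i)) ℝ) (v : (Σ i : ι, Fin (m i)) → ℝ) :
    blockProj m i (Matrix.blockDiagonal' A *ᵥ v) = A i *ᵥ blockProj m i v := by
  ext l
  rw [blockProj_apply]
  simp only [Matrix.mulVec, dotProduct, Fintype.sum_sigma, blockProj_apply]
  rw [Finset.sum_eq_single i]
  · simp [Matrix.blockDiagonal'_apply]
  · intro k _ hk
    simp [Matrix.blockDiagonal'_apply, Ne.symm hk]
  · simp

theorem blockProj_filter_term {ny : ℕ} (m : Fin ny → ℕ) (i : Fin ny)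
    (A : ∀ i, Matrix (Fin (m i)) (Fin (m i)) ℝ) (b : ∀ i, Fin (m i) → ℝ) (γ : ℝ)
    (v : Fin ny → ℝ) (j : ℕ) :
    blockProj m i ((γ • Matrix.blockDiagonal' A) ^ j *ᵥ (Bdiag b *ᵥ v)) =
      (v i * γ ^ j) • (A i ^ j *ᵥ b i) := by
  have hB : blockProj m i (Bdiag b *ᵥ v) = v i • b i := by
    ext l
    simp [blockProj_apply, Bdiag, Matrix.mulVec, dotProduct, mul_comm]
  rw [smul_pow, ← Matrix.blockDiagonal'_pow, Matrix.smul_mulVec, map_smul,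
    blockProj_blockDiagonal'_mulVec, hB, Pi.pow_apply, Matrix.mulVec_smul, smul_smul, mul_comm]

theorem norm_iterate_add_one_le {E : Type*} [SeminormedAddCommGroup E] {g : E → E} {L : ℝ}
    (hL : 0 ≤ L) (hg : ∀ x y, ‖g x - g y‖ ≤ L * ‖x - y‖) (x : E) (j : ℕ) :
    ‖g^[j] x‖ + 1 ≤ (L + ‖g 0‖ + 1) ^ j * (‖x‖ + 1) := by
  induction j with
  | zero => simp
  | succ j ih =>
    rw [Function.iterate_succ_apply', pow_succ', mul_assoc]
    have h1 : ‖g (g^[j] x)‖ ≤ L * ‖g^[j] x‖ + ‖g 0‖ := by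
      have h2 := hg (g^[j] x) 0
      have h3 := norm_sub_norm_le (g (g^[j] x)) (g 0)
      rw [sub_zero] at h2
      linarith
    have h4 := norm_nonneg (g^[j] x)
    have h5 := norm_nonneg (g 0)
    calc ‖g (g^[j] x)‖ + 1 ≤ (L + ‖g 0‖ + 1) * (‖g^[j] x‖ + 1) := by nlinarith
      _ ≤ _ := mul_le_mul_of_nonneg_left ih (by positivity)

theorem norm_iterate_sub_le {E : Type*} [SeminormedAddCommGroup E] {g : E → E} {L : ℝ}
    (hL : 0 ≤ L) (hg : ∀ x y, ‖g x - g y‖ ≤ L * ‖x - y‖) (x y : E) (j : ℕ) :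
    ‖g^[j] x - g^[j] y‖ ≤ L ^ j * ‖x - y‖ := by
  induction j with
  | zero => simp
  | succ j ih =>
    rw [Function.iterate_succ_apply', Function.iterate_succ_apply', pow_succ', mul_assoc]
    exact (hg _ _).trans (mul_le_mul_of_nonneg_left ih hL)

/-- under Lipschitz backward distinguishability on `X`, with controllable
Schur pairs `(Ã_i, B̃_i)`, there exist `γ* ∈ (0,1]` and `c_I > 0` (independent of `γ`) such
that for all `γ ∈ (0, γ*)`, the map
`T(x) = Σ_{j=0}^∞ Aʲ B h((f⁻¹)^{∘(j+1)}(x))`, with `A = γ diag(Ã_1,…,Ã_{n_y})` and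
`B = diag(B̃_1,…,B̃_{n_y})`, is well defined on `X` and Lipschitz injective on `X` with
lower Lipschitz constant `c_I γ^{m̄ − 1}`. -/
theorem stmt4 {nx ny : ℕ} (hny : 0 < ny)
    (X : Set (Fin nx → ℝ))
    (f g : (Fin nx → ℝ) → (Fin nx → ℝ))
    (hfg : Function.LeftInverse g f) (hgf : Function.RightInverse g f)
    (h : (Fin nx → ℝ) → (Fin ny → ℝ))
    (cf ch co : ℝ) (hcf : 0 < cf) (hch : 0 < ch) (hco : 0 < co)
    (hg : ∀ xa xb, ‖g xa - g xb‖ ≤ cf * ‖xa - xb‖)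
    (hh : ∀ xa xb, ‖h xa - h xb‖ ≤ ch * ‖xa - xb‖)
    (m : Fin ny → ℕ) (hm : ∀ i, 1 ≤ m i)
    (hobs : ∀ xa ∈ X, ∀ xb ∈ X,
      co * ‖xa - xb‖ ≤ ‖obsMap m g h xa - obsMap m g h xb‖)
    (At : ∀ i : Fin ny, Matrix (Fin (m i)) (Fin (m i)) ℝ)
    (Bt : ∀ i : Fin ny, Fin (m i) → ℝ)
    (hAt : ∀ i, IsSchur (At i))
    (hctrb : ∀ i, IsUnit (ctrbMat (At i) (Bt i)).det) :
    ∃ γstar cI : ℝ, γstar ∈ Set.Ioc (0 : ℝ) 1 ∧ 0 < cI ∧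
      ∀ γ : ℝ, γ ∈ Set.Ioo 0 γstar →
        (∀ x ∈ X, Summable fun j : ℕ =>
          ‖((γ • Matrix.blockDiagonal' At) ^ j) *ᵥ (Bdiag Bt *ᵥ h (g^[j + 1] x))‖) ∧
        (∀ xa ∈ X, ∀ xb ∈ X,
          cI * γ ^ (Finset.univ.sup m - 1) * ‖xa - xb‖ ≤
            ‖(∑' j : ℕ, ((γ • Matrix.blockDiagonal' At) ^ j) *ᵥ (Bdiag Bt *ᵥ h (g^[j + 1] xa)))
              - (∑' j : ℕ,
                  ((γ • Matrix.blockDiagonal' At) ^ j) *ᵥ (Bdiag Bt *ᵥ h (g^[j + 1] xb)))‖) := by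
  have : Nonempty (Σ i : Fin ny, Fin (m i)) := ⟨⟨⟨0, hny⟩, ⟨0, hm _⟩⟩⟩
  set M := Matrix.blockDiagonal' At with hM
  set c := cf + ‖g 0‖ + 1 with hc
  have hc0 : 0 < c := by positivity
  have hcfc : cf ≤ c := by linarith [norm_nonneg (g 0)]
  have hη : 0 < co / (ch * c) := by positivity
  obtain ⟨k, hk, hk0⟩ := ((Filter.eventually_all.2 fun i =>
    eventually_le_norm_tsum_of_controllable (At i) (Bt i) (hctrb i) hc0.le hη).and
    self_mem_nhdsWithin).exists
  have hk0 : 0 < k := hk0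
  have hsmall : ∀ᶠ γ in nhdsWithin (0 : ℝ) (Set.Ioi 0), γ * ‖M‖ * c < 1 :=
    nhdsWithin_le_nhds ((by fun_prop : Continuous fun γ : ℝ => γ * ‖M‖ * c).continuousAt
      |>.eventually_lt_const (by simp))
  obtain ⟨γ₀, hγ₀, hsub⟩ := mem_nhdsGT_iff_exists_Ioo_subset.1
    ((Filter.eventually_all.2 hk).and hsmall)
  have hγ₀ : 0 < γ₀ := hγ₀
  refine ⟨min γ₀ 1, k * (ch * c), ⟨lt_min hγ₀ one_pos, min_le_right _ _⟩, by positivity, ?_⟩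
  rintro γ ⟨hγ0, hγ⟩
  have hγ1 : γ < 1 := hγ.trans_le (min_le_right _ _)
  obtain ⟨hblock, hγM⟩ := hsub ⟨hγ0, hγ.trans_le (min_le_left _ _)⟩
  have hsum : ∀ x, Summable fun j : ℕ =>
      ‖((γ • M) ^ j) *ᵥ (Bdiag Bt *ᵥ h (g^[j + 1] x))‖ := by
    intro x
    refine Summable.of_nonneg_of_le (fun _ => norm_nonneg _) (fun j => ?_)
      ((summable_geometric_of_lt_one (by positivity) hγM).mul_left
        (‖Bdiag Bt‖ * ((ch + ‖h 0‖) * (c * (‖x‖ + 1)))))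
    have hhb : ‖h (g^[j + 1] x)‖ ≤ (ch + ‖h 0‖) * (c ^ (j + 1) * (‖x‖ + 1)) := by
      have h1 := hh (g^[j + 1] x) 0
      have h2 := norm_sub_norm_le (h (g^[j + 1] x)) (h 0)
      rw [sub_zero] at h1
      have h3 := norm_nonneg (g^[j + 1] x)
      have h4 := norm_nonneg (h 0)
      calc ‖h (g^[j + 1] x)‖ ≤ (ch + ‖h 0‖) * (‖g^[j + 1] x‖ + 1) := by nlinarith
        _ ≤ _ := mul_le_mul_of_nonneg_left (norm_iterate_add_one_le hcf.le hg x _)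
          (by positivity)
    rw [smul_pow, Matrix.smul_mulVec, norm_smul, Real.norm_of_nonneg (by positivity)]
    calc γ ^ j * ‖M ^ j *ᵥ (Bdiag Bt *ᵥ h (g^[j + 1] x))‖
        ≤ γ ^ j * (‖M‖ ^ j * (‖Bdiag Bt‖ * ((ch + ‖h 0‖) * (c ^ (j + 1) * (‖x‖ + 1))))) := by
          gcongr
          refine (norm_pow_mulVec_le M _ j).trans ?_
          gcongr
          refine (Matrix.linfty_opNorm_mulVec _ _).trans ?_
          gcongr
      _ = _ := by rw [mul_pow, mul_pow]; ring
  refine ⟨fun x _ => hsum x, fun xa ha xb hb => ?_⟩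
  rw [← (hsum xa).of_norm.tsum_sub (hsum xb).of_norm]
  have hdiff : Summable fun j : ℕ => ((γ • M) ^ j) *ᵥ (Bdiag Bt *ᵥ h (g^[j + 1] xa)) -
      ((γ • M) ^ j) *ᵥ (Bdiag Bt *ᵥ h (g^[j + 1] xb)) :=
    (hsum xa).of_norm.sub (hsum xb).of_norm
  obtain ⟨⟨i, l⟩, hil⟩ := Finite.exists_max fun p =>
    ‖(obsMap m g h xa - obsMap m g h xb) p‖
  have hmax : ‖obsMap m g h xa - obsMap m g h xb‖ ≤
      ‖(obsMap m g h xa - obsMap m g h xb) ⟨i, l⟩‖ :=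
    (pi_norm_le_iff_of_nonneg (norm_nonneg _)).2 hil
  have hlow := hblock i (fun j => (h (g^[j + 1] xa) - h (g^[j + 1] xb)) i)
    (ch * c * ‖xa - xb‖) (by positivity)
    (fun j => by
      calc |(h (g^[j + 1] xa) - h (g^[j + 1] xb)) i| ≤ ‖h (g^[j + 1] xa) - h (g^[j + 1] xb)‖ :=
            norm_le_pi_norm (h (g^[j + 1] xa) - h (g^[j + 1] xb)) i
        _ ≤ ch * ‖g^[j + 1] xa - g^[j + 1] xb‖ := hh _ _
        _ ≤ ch * (c ^ (j + 1) * ‖xa - xb‖) := by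
            gcongr
            refine (norm_iterate_sub_le hcf.le hg xa xb _).trans ?_
            gcongr
        _ = _ := by ring) l
    (by
      calc co / (ch * c) * (ch * c * ‖xa - xb‖) = co * ‖xa - xb‖ := by field_simp
        _ ≤ _ := (hobs xa ha xb hb).trans hmax)
  have hproj : blockProj m i (∑' j : ℕ, (((γ • M) ^ j) *ᵥ (Bdiag Bt *ᵥ h (g^[j + 1] xa)) -
      ((γ • M) ^ j) *ᵥ (Bdiag Bt *ᵥ h (g^[j + 1] xb)))) =
      ∑' j : ℕ, ((h (g^[j + 1] xa) - h (g^[j + 1] xb)) i * γ ^ j) • (At i ^ j *ᵥ Bt i) := by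
    rw [ContinuousLinearMap.map_tsum _ hdiff]
    congr 1 with j : 1
    rw [← Matrix.mulVec_sub, ← Matrix.mulVec_sub, blockProj_filter_term]
  rw [← hproj] at hlow
  refine le_trans ?_ (hlow.trans (norm_blockProj_le m i _))
  calc k * (ch * c) * γ ^ (Finset.univ.sup m - 1) * ‖xa - xb‖
      ≤ k * (ch * c) * γ ^ (m i - 1) * ‖xa - xb‖ := by
        gcongr ?_ * ?_ * ?_
        exact pow_le_pow_of_le_one hγ0.le hγ1.le
          (Nat.sub_le_sub_right (Finset.le_sup (Finset.mem_univ i)) 1)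
    _ = _ := by ring
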